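/- arXiv:2209.10690 — 2 statements merged into one kernel-verified Lean document; each statement's English description precedes it below -/
import Mathlib

section
/- For every real number a > 0, the function E_a satisfies: E_a(0) = a^20 · exp(-1/a²), the first derivative of E_a at 0 is 0, the third derivative of E_a at 0 is 0, and the fourth derivative of E_a at 0 equals 4a⁴ · (270a¹² + 54a¹⁰ + 3a⁸) · exp(-1/a²). -/
open Real

noncomputable def Ea (a : ℝ) : ℝ → ℝ := fun t =>
  if |t| < a then Real.exp (-1 / (a ^ 2 - t ^ 2)) * (a ^ 2 - t ^ 2) ^ 10 else 0

/-- The derivative of `exp (-1 / (a² - t²)) * (a² - t²) ^ (n + 2)` in `t`. -/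
lemma hasDerivAt_exp_neg_one_div_mul_pow (a : ℝ) (n : ℕ) {t : ℝ} (ht : a ^ 2 - t ^ 2 ≠ 0) :
    HasDerivAt (fun s : ℝ => exp (-1 / (a ^ 2 - s ^ 2)) * (a ^ 2 - s ^ 2) ^ (n + 2))
      (-2 * t * (exp (-1 / (a ^ 2 - t ^ 2)) *
        ((a ^ 2 - t ^ 2) ^ n + (n + 2) * (a ^ 2 - t ^ 2) ^ (n + 1)))) t := by
  have hu : HasDerivAt (fun s : ℝ => a ^ 2 - s ^ 2) (-2 * t) t := by
    simpa using (hasDerivAt_pow 2 t).const_sub (a ^ 2)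
  have he := ((hasDerivAt_const t (-1 : ℝ)).fun_div hu ht).exp
  refine (he.fun_mul (hu.fun_pow (n + 2))).congr_deriv ?_
  rw [show n + 2 - 1 = n + 1 by omega]
  push_cast
  field_simp
  ring

/-- If `f` is given by `F` on an open interval, then so is its derivative by that of `F`. -/
lemma deriv_eq_of_eqOn_Ioo {f F F' : ℝ → ℝ} {b c : ℝ} (h : Set.EqOn f F (Set.Ioo b c))
    (hF : ∀ t ∈ Set.Ioo b c, HasDerivAt F (F' t) t) :
    Set.EqOn (deriv f) F' (Set.Ioo b c) := fun t ht =>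
  (h.eventuallyEq_of_mem (isOpen_Ioo.mem_nhds ht)).deriv_eq.trans (hF t ht).deriv

theorem Ea_values_at_zero (a : ℝ) (ha : 0 < a) :
    Ea a 0 = a ^ 20 * Real.exp (-1 / a ^ 2) ∧
    deriv (Ea a) 0 = 0 ∧
    iteratedDeriv 3 (Ea a) 0 = 0 ∧
    iteratedDeriv 4 (Ea a) 0 =
      4 * a ^ 4 * (270 * a ^ 12 + 54 * a ^ 10 + 3 * a ^ 8) * Real.exp (-1 / a ^ 2) := by
  let g : ℕ → ℝ → ℝ := fun n t => exp (-1 / (a ^ 2 - t ^ 2)) * (a ^ 2 - t ^ 2) ^ (n + 2)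
  have hg (n : ℕ) {t : ℝ} (ht : t ∈ Set.Ioo (-a) a) :
      HasDerivAt (g n) (-2 * t * (exp (-1 / (a ^ 2 - t ^ 2)) *
        ((a ^ 2 - t ^ 2) ^ n + (n + 2) * (a ^ 2 - t ^ 2) ^ (n + 1)))) t :=
    hasDerivAt_exp_neg_one_div_mul_pow a n (by nlinarith [ht.1, ht.2])
  have h0 : Set.EqOn (Ea a) (g 8) (Set.Ioo (-a) a) := fun t ht => by
    simp [Ea, g, abs_lt.2 ht]
  have h1 : Set.EqOn (deriv (Ea a)) (fun t => -2 * t * (g 6 t + 10 * g 7 t))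
      (Set.Ioo (-a) a) := by
    refine deriv_eq_of_eqOn_Ioo h0 fun t ht => (hg 8 ht).congr_deriv ?_
    simp only [g]
    push_cast
    ring
  have h2 : Set.EqOn (deriv (deriv (Ea a)))
      (fun t => -2 * (g 6 t + 10 * g 7 t) + 4 * t ^ 2 * (g 4 t + 18 * g 5 t + 90 * g 6 t))
      (Set.Ioo (-a) a) := by
    refine deriv_eq_of_eqOn_Ioo h1 fun t ht =>
      (((hasDerivAt_id' t).const_mul (-2)).fun_mul
        ((hg 6 ht).fun_add ((hg 7 ht).const_mul 10))).congr_deriv ?_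
    simp only [g]
    push_cast
    ring
  have h3 : Set.EqOn (deriv (deriv (deriv (Ea a))))
      (fun t => 12 * t * (g 4 t + 18 * g 5 t + 90 * g 6 t) -
        8 * t ^ 3 * (g 2 t + 24 * g 3 t + 216 * g 4 t + 720 * g 5 t))
      (Set.Ioo (-a) a) := by
    refine deriv_eq_of_eqOn_Ioo h2 fun t ht =>
      ((((hg 6 ht).fun_add ((hg 7 ht).const_mul 10)).const_mul (-2)).fun_add
        (((hasDerivAt_pow 2 t).const_mul 4).fun_mul
          (((hg 4 ht).fun_add ((hg 5 ht).const_mul 18)).fun_add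
            ((hg 6 ht).const_mul 90)))).congr_deriv ?_
    simp only [g]
    push_cast
    ring
  have hz : (0 : ℝ) ∈ Set.Ioo (-a) a := ⟨by linarith, ha⟩
  have h4 : HasDerivAt (deriv (deriv (deriv (Ea a))))
      (12 * (g 4 0 + 18 * g 5 0 + 90 * g 6 0)) 0 := by
    refine HasDerivAt.congr_of_eventuallyEq (HasDerivAt.congr_deriv
      ((((hasDerivAt_id' (0 : ℝ)).const_mul 12).fun_mul
        (((hg 4 hz).fun_add ((hg 5 hz).const_mul 18)).fun_add ((hg 6 hz).const_mul 90))).fun_sub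
      (((hasDerivAt_pow 3 (0 : ℝ)).const_mul 8).fun_mul
        ((((hg 2 hz).fun_add ((hg 3 hz).const_mul 24)).fun_add
          ((hg 4 hz).const_mul 216)).fun_add ((hg 5 hz).const_mul 720)))) ?_)
      (h3.eventuallyEq_of_mem (isOpen_Ioo.mem_nhds hz))
    simp
  refine ⟨?_, ?_, ?_, ?_⟩
  · rw [h0 hz]
    simp only [g]
    ring_nf
  · simp [h1 hz]
  · simp only [iteratedDeriv_succ, iteratedDeriv_zero]
    simp [h3 hz]
  · simp only [iteratedDeriv_succ, iteratedDeriv_zero]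
    rw [h4.deriv]
    simp only [g]
    ring_nf
end

section
/- For every real number a > 0 there exist real numbers b and c such that the function η : ℝ → ℝ defined by η(t) = E_a(t) · (1 - b·t² + c·t⁴) satisfies η(0) = E_a(0) > 0 and the i-th derivative of η at 0 vanishes for every i ∈ {1, 2, 3, 4}. -/
open Real

theorem Ea_neg (a t : ℝ) : Ea a (-t) = Ea a t := by
  simp [Ea]

theorem Ea_zero_pos {a : ℝ} (ha : 0 < a) : 0 < Ea a 0 := by
  rw [Ea, if_pos (by rwa [abs_zero]), zero_pow two_ne_zero, sub_zero]
  positivity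

theorem contDiffAt_Ea_zero {a : ℝ} (ha : 0 < a) {n : WithTop ℕ∞} : ContDiffAt ℝ n (Ea a) 0 := by
  have h : ContDiffAt ℝ n
      (fun t : ℝ => Real.exp (-1 / (a ^ 2 - t ^ 2)) * (a ^ 2 - t ^ 2) ^ 10) 0 := by
    have hne : a ^ 2 - (0 : ℝ) ^ 2 ≠ 0 := by
      rw [zero_pow two_ne_zero, sub_zero]
      positivity
    have hd : ContDiffAt ℝ n (fun t : ℝ => a ^ 2 - t ^ 2) 0 := by fun_prop
    exact (contDiffAt_const.div hd hne).exp.mul (hd.pow 10)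
  refine h.congr_of_eventuallyEq ?_
  filter_upwards [Metric.ball_mem_nhds (0 : ℝ) ha] with t ht
  rw [mem_ball_zero_iff, Real.norm_eq_abs] at ht
  simp only [Ea, if_pos ht]

theorem iteratedDeriv_zero_eq_zero_of_even {f : ℝ → ℝ} (hf : ∀ t, f (-t) = f t) {n : ℕ}
    (hn : Odd n) : iteratedDeriv n f 0 = 0 := by
  have h := iteratedDeriv_comp_neg n f 0
  simp only [hf, hn.neg_one_pow, neg_zero, neg_smul, one_smul] at h
  linarith

theorem iteratedDeriv_even_quartic_zero (b c : ℝ) (n : ℕ) :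
    iteratedDeriv n (fun t : ℝ => 1 - b * t ^ 2 + c * t ^ 4) 0 =
      (if n = 0 then 1 else 0) - b * (if n = 2 then 2 else 0) + c * (if n = 4 then 24 else 0) := by
  have h1 : ContDiffAt ℝ n (fun _ : ℝ => (1 : ℝ)) 0 := contDiffAt_const
  have h2 : ContDiffAt ℝ n (fun t : ℝ => b * t ^ 2) 0 := by fun_prop
  have h4 : ContDiffAt ℝ n (fun t : ℝ => c * t ^ 4) 0 := by fun_prop
  have h := iteratedDeriv_fun_add (h1.sub h2) h4
  rw [iteratedDeriv_fun_sub h1 h2, iteratedDeriv_const_mul_field, iteratedDeriv_const_mul_field,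
    iteratedDeriv_fun_pow_zero, iteratedDeriv_fun_pow_zero, iteratedDeriv_const] at h
  simpa [Nat.factorial] using h

theorem exists_even_quartic_correction {f : ℝ → ℝ} (hf : ContDiffAt ℝ 4 f 0)
    (hev : ∀ t, f (-t) = f t) (h0 : f 0 ≠ 0) :
    ∃ b c : ℝ, ∀ i ∈ ({1, 2, 3, 4} : Finset ℕ),
      iteratedDeriv i (fun t => f t * (1 - b * t ^ 2 + c * t ^ 4)) 0 = 0 := by
  set b := iteratedDeriv 2 f 0 / (2 * f 0) with hb
  set c := (12 * b * iteratedDeriv 2 f 0 - iteratedDeriv 4 f 0) / (24 * f 0) with hc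
  have hodd {n : ℕ} (hn : Odd n) :
      iteratedDeriv n (fun t => f t * (1 - b * t ^ 2 + c * t ^ 4)) 0 = 0 :=
    iteratedDeriv_zero_eq_zero_of_even (fun t => by rw [hev]; ring) hn
  have hleib {n : ℕ} (hn : n ≤ 4) :
      iteratedDeriv n (fun t => f t * (1 - b * t ^ 2 + c * t ^ 4)) 0 = _ :=
    iteratedDeriv_fun_mul (hf.of_le (by exact_mod_cast hn)) (by fun_prop)
  refine ⟨b, c, fun i hi => ?_⟩
  simp only [Finset.mem_insert, Finset.mem_singleton] at hi
  rcases hi with rfl | rfl | rfl | rfl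
  · exact hodd (by decide)
  · rw [hleib (by norm_num)]
    simp [Finset.sum_range_succ, iteratedDeriv_even_quartic_zero]
    rw [hb]
    field_simp
    ring
  · exact hodd (by decide)
  · rw [hleib le_rfl]
    simp [Finset.sum_range_succ, iteratedDeriv_even_quartic_zero, Nat.choose]
    rw [hc]
    field_simp
    ring

theorem exists_correction (a : ℝ) (ha : 0 < a) :
    ∃ b c : ℝ,
      (fun t => Ea a t * (1 - b * t ^ 2 + c * t ^ 4)) 0 = Ea a 0 ∧
      0 < Ea a 0 ∧
      ∀ i ∈ ({1, 2, 3, 4} : Finset ℕ),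
        iteratedDeriv i (fun t => Ea a t * (1 - b * t ^ 2 + c * t ^ 4)) 0 = 0 := by
  obtain ⟨b, c, h⟩ :=
    exists_even_quartic_correction (contDiffAt_Ea_zero ha) (Ea_neg a) (Ea_zero_pos ha).ne'
  exact ⟨b, c, by simp, Ea_zero_pos ha, h⟩
end
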